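/- Let I, J be nonempty disjoint subsets of [n] with I ∪ J = [n], and let x, a ∈ (Rmax)^n, both different from ⊥. Set M_I = max_{i∈I}(x_i + a_i) and M_J = max_{j∈J}(x_j + a_j). If at least one of M_I, M_J is finite, then dist_H(x, H^{IJ}_a) = |M_I − M_J| (with |r − (−∞)| = +∞ for r ∈ R); and if M_I = M_J = −∞, then dist_H(x, H^{IJ}_a) = 0. -/

import Mathlib

open scoped Classical BigOperators

noncomputable section

namespace TropReg

/-- `x` is a vector of `Rmax = ℝ ∪ {-∞}`, modeled inside `EReal` as having no `+∞` entry. -/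
def IsRmax {n : ℕ} (x : Fin n → EReal) : Prop := ∀ i, x i ≠ ⊤

/-- Embedding of a real vector into `(Rmax)^n`. -/
def ofReal {n : ℕ} (a : Fin n → ℝ) : Fin n → EReal := fun i => (a i : EReal)

/-- Hilbert's projective metric on `(Rmax)^n`, with values in `[0,+∞] ⊆ EReal`;
`d(⊥,⊥) = 0` by convention, and the infimum of the empty set is `+∞`. -/
def hd {n : ℕ} (x y : Fin n → EReal) : EReal :=
  if x = ⊥ ∧ y = ⊥ then 0
  else sInf { t : EReal | ∃ lam mu : ℝ, t = (lam : EReal) - (mu : EReal) ∧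
        (∀ i, (mu : EReal) + y i ≤ x i) ∧ (∀ i, x i ≤ (lam : EReal) + y i) }

/-- Closed Hilbert ball of center `a` and radius `r`, inside `(Rmax)^n`. -/
def ball {n : ℕ} (a : Fin n → EReal) (r : EReal) : Set (Fin n → EReal) :=
  { x | IsRmax x ∧ hd a x ≤ r }

/-- Hilbert distance from a point to a set. -/
def distPt {n : ℕ} (x : Fin n → EReal) (B : Set (Fin n → EReal)) : EReal :=
  ⨅ b ∈ B, hd x b

/-- One-sided Hausdorff distance from `A` to `B` for Hilbert's metric. -/
def distHS {n : ℕ} (A B : Set (Fin n → EReal)) : EReal :=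
  ⨆ a ∈ A, distPt a B

/-- Tropical hyperplane associated with `a`: the maximum `max_i (a_i + x_i)` is
attained at least twice. -/
def hyper {n : ℕ} (a : Fin n → EReal) : Set (Fin n → EReal) :=
  { x | IsRmax x ∧ ∃ i j : Fin n, i ≠ j ∧
      a i + x i = (⨆ k, a k + x k) ∧ a j + x j = (⨆ k, a k + x k) }

/-- Tropical column space of the matrix `V`. -/
def colSpace {n p : ℕ} (V : Fin n → Fin p → EReal) : Set (Fin n → EReal) :=
  { y | ∃ x : Fin p → EReal, IsRmax x ∧ y = fun i => ⨆ k, (V i k + x k) }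

/-- The `k`-th column of `V`. -/
def col {n p : ℕ} (V : Fin n → Fin p → EReal) (k : Fin p) : Fin n → EReal :=
  fun i => V i k

/-- The set of columns of `V`. -/
def cols {n p : ℕ} (V : Fin n → Fin p → EReal) : Set (Fin n → EReal) :=
  Set.range (col V)

/-- The Shapley operator associated with the matrix `V`. -/
def TV {n p : ℕ} (V : Fin n → Fin p → EReal) (x : Fin n → EReal) : Fin n → EReal :=
  fun i => ⨅ k ∈ { k : Fin p | V i k ≠ ⊥ },
    (-(V i k) + ⨆ j ∈ { j : Fin n | j ≠ i }, (V j k + x j))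

/-- Tropical spectral radius of an operator `T`. -/
def rho {n : ℕ} (T : (Fin n → EReal) → (Fin n → EReal)) : EReal :=
  sSup { lam : EReal | lam ≠ ⊤ ∧ ∃ u : Fin n → EReal, IsRmax u ∧ u ≠ ⊥ ∧
      T u = fun i => lam + u i }

/-- Tropical convex cone in `(Rmax)^n`. -/
def IsTropCone {n : ℕ} (C : Set (Fin n → EReal)) : Prop :=
  (∀ x ∈ C, ∀ y ∈ C, (fun i => x i ⊔ y i) ∈ C) ∧
  (∀ x ∈ C, ∀ lam : EReal, lam ≠ ⊤ → (fun i => lam + x i) ∈ C)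

/-- Tropical span: smallest tropical cone containing `Vs`. -/
def span {n : ℕ} (Vs : Set (Fin n → EReal)) : Set (Fin n → EReal) :=
  ⋂₀ { C | IsTropCone C ∧ Vs ⊆ C }

/-- Inner radius: supremum of radii of Hilbert balls centered at finite points
included in `W`. -/
def inradius {n : ℕ} (W : Set (Fin n → EReal)) : EReal :=
  sSup { r : EReal | ∃ s : ℝ, r = (s : EReal) ∧ 0 ≤ s ∧
      ∃ a : Fin n → ℝ, ball (ofReal a) r ⊆ W }


/-- Signed tropical hyperplane of type `(I,J)`. -/
def shyper {n : ℕ} (I J : Set (Fin n)) (a : Fin n → EReal) : Set (Fin n → EReal) :=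
  { x | IsRmax x ∧ (⨆ i ∈ I, (a i + x i)) = ⨆ j ∈ J, (a j + x j) }

/-- Translation by a real number commutes with suprema in `EReal`. -/
lemma biSup_coe_add {ι : Type*} (S : Set ι) (c : ℝ) (f : ι → EReal) :
    (⨆ i ∈ S, ((c : EReal) + f i)) = c + ⨆ i ∈ S, f i := by
  have coe_add_neg_add (c : ℝ) (z : EReal) : (c : EReal) + (((-c : ℝ) : EReal) + z) = z := by
    rw [← add_assoc, ← EReal.coe_add, add_neg_cancel, EReal.coe_zero, zero_add]
  have le_add (c : ℝ) (f : ι → EReal) :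
      (⨆ i ∈ S, ((c : EReal) + f i)) ≤ c + ⨆ i ∈ S, f i :=
    iSup₂_le fun i hi => add_le_add le_rfl (le_iSup₂ (f := fun i (_ : i ∈ S) => f i) i hi)
  refine le_antisymm (le_add c f) ?_
  have h := le_add (-c) fun i => (c : EReal) + f i
  have h_cancel (z : EReal) : ((-c : ℝ) : EReal) + ((c : EReal) + z) = z := by
    simpa using coe_add_neg_add (-c) z
  simp only [h_cancel] at h
  calc (c : EReal) + ⨆ i ∈ S, f i
      ≤ c + (((-c : ℝ) : EReal) + ⨆ i ∈ S, ((c : EReal) + f i)) := add_le_add le_rfl h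
    _ = _ := coe_add_neg_add c _

lemma biSup_add_ne_top {n : ℕ} (S : Set (Fin n)) {x a : Fin n → EReal} (hx : IsRmax x)
    (ha : IsRmax a) : (⨆ i ∈ S, (x i + a i)) ≠ ⊤ := by
  rw [← lt_top_iff_ne_top, ← sSup_image]
  rcases S.eq_empty_or_nonempty with rfl | hS
  · simp
  · obtain ⟨i, -, hi⟩ := (hS.image fun i => x i + a i).csSup_mem
      (S.toFinite.image fun i => x i + a i)
    rw [← hi]
    exact EReal.add_lt_top (hx i) (ha i)

lemma shyper_comm {n : ℕ} (I J : Set (Fin n)) (a : Fin n → EReal) :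
    shyper I J a = shyper J I a := by
  ext y
  exact and_congr_right fun _ => eq_comm

lemma hd_le {n : ℕ} {x y : Fin n → EReal} (hxb : x ≠ ⊥) (lam mu : ℝ)
    (hmu : ∀ i, (mu : EReal) + y i ≤ x i) (hlam : ∀ i, x i ≤ (lam : EReal) + y i) :
    hd x y ≤ (lam : EReal) - mu := by
  rw [hd, if_neg fun h => hxb h.1]
  exact sInf_le ⟨lam, mu, rfl, hmu, hlam⟩

lemma le_hd {n : ℕ} {x y : Fin n → EReal} (hxb : x ≠ ⊥) {t : EReal}
    (h : ∀ lam mu : ℝ, (∀ i, (mu : EReal) + y i ≤ x i) → (∀ i, x i ≤ (lam : EReal) + y i) →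
      t ≤ (lam : EReal) - mu) : t ≤ hd x y := by
  rw [hd, if_neg fun h => hxb h.1]
  refine le_sInf ?_
  rintro _ ⟨lam, mu, rfl, hmu, hlam⟩
  exact h lam mu hmu hlam

lemma hd_nonneg {n : ℕ} {x y : Fin n → EReal} (hxb : x ≠ ⊥) (hy : IsRmax y) : 0 ≤ hd x y := by
  refine le_hd hxb fun lam mu hmu hlam => ?_
  obtain ⟨i, hi⟩ := Function.ne_iff.mp hxb
  have hyi : y i ≠ ⊥ := by
    intro h
    have := hlam i
    rw [h, EReal.add_bot, le_bot_iff] at this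
    exact hi this
  have h := (hmu i).trans (hlam i)
  lift y i to ℝ using ⟨hy i, hyi⟩ with z
  norm_cast at h ⊢
  linarith

lemma biSup_sub_biSup_le_distPt {n : ℕ} (I J : Set (Fin n)) {x : Fin n → EReal}
    (a : Fin n → EReal) (hxb : x ≠ ⊥) :
    (⨆ i ∈ I, (x i + a i)) - (⨆ j ∈ J, (x j + a j)) ≤ distPt x (shyper I J a) := by
  refine le_iInf₂ fun y hy => le_hd hxb fun lam mu hmu hlam => ?_
  have upper : (⨆ i ∈ I, (x i + a i)) ≤ lam + ⨆ i ∈ I, (a i + y i) := by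
    rw [← biSup_coe_add]
    refine iSup₂_mono fun i _ => ?_
    rw [add_comm (a i), ← add_assoc]
    exact add_le_add (hlam i) le_rfl
  have lower : mu + (⨆ j ∈ J, (a j + y j)) ≤ ⨆ j ∈ J, (x j + a j) := by
    rw [← biSup_coe_add]
    refine iSup₂_mono fun j _ => ?_
    rw [add_comm (a j), ← add_assoc]
    exact add_le_add (hmu j) le_rfl
  rw [hy.2] at upper
  refine EReal.sub_le_of_le_add (upper.trans ?_)
  calc (lam : EReal) + ⨆ j ∈ J, (a j + y j)
      = ((lam : EReal) - mu) + (mu + ⨆ j ∈ J, (a j + y j)) := by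
        rw [← add_assoc, ← EReal.coe_sub, ← EReal.coe_add, sub_add_cancel]
    _ ≤ _ := add_le_add le_rfl lower

/-- Shifting the coordinates of `x` in `I` by `M_J - M_I` gives a point of the hyperplane. -/
lemma distPt_shyper_le {n : ℕ} {I J : Set (Fin n)} (hdisj : Disjoint I J)
    {x a : Fin n → EReal} (hx : IsRmax x) (hxb : x ≠ ⊥) {r s : ℝ}
    (hr : (⨆ i ∈ I, (x i + a i)) = r) (hs : (⨆ j ∈ J, (x j + a j)) = s) (hsr : s ≤ r) :
    distPt x (shyper I J a) ≤ (r : EReal) - s := by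
  let y : Fin n → EReal := fun i => if i ∈ I then ((s - r : ℝ) : EReal) + x i else x i
  have hy : y ∈ shyper I J a := by
    refine ⟨fun i => ?_, ?_⟩
    · by_cases hi : i ∈ I
      · simpa [y, hi] using (EReal.add_lt_top (EReal.coe_ne_top (s - r)) (hx i)).ne
      · simpa [y, hi] using hx i
    · have hyI : (⨆ i ∈ I, (a i + y i)) = ⨆ i ∈ I, (((s - r : ℝ) : EReal) + (x i + a i)) :=
        biSup_congr fun i hi => by
          simp only [y, if_pos hi]
          rw [add_comm, add_assoc]
      have hyJ : (⨆ j ∈ J, (a j + y j)) = ⨆ j ∈ J, (x j + a j) :=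
        biSup_congr fun j hj => by
          simp only [y, if_neg (hdisj.notMem_of_mem_right hj)]
          rw [add_comm]
      rw [hyI, hyJ, biSup_coe_add, hr, hs, ← EReal.coe_add, sub_add_cancel]
  refine (iInf₂_le y hy).trans ?_
  have hle (c : ℝ) (hc : c ≤ 0) (z : EReal) : (c : EReal) + z ≤ z := by
    simpa using add_le_add (show (c : EReal) ≤ 0 by exact_mod_cast hc) (le_refl z)
  have hge (c : ℝ) (hc : 0 ≤ c) (z : EReal) : z ≤ (c : EReal) + z := by
    simpa using add_le_add (show (0 : EReal) ≤ c by exact_mod_cast hc) (le_refl z)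
  have h := hd_le (y := y) hxb (r - s) 0 (fun i => ?_) (fun i => ?_)
  · simpa using h
  · rw [EReal.coe_zero, zero_add]
    by_cases hi : i ∈ I
    · simpa only [y, if_pos hi] using hle (s - r) (by linarith) (x i)
    · simp [y, hi]
  · by_cases hi : i ∈ I
    · simp only [y, if_pos hi]
      rw [← add_assoc, ← EReal.coe_add, sub_add_sub_cancel, sub_self, EReal.coe_zero, zero_add]
    · simpa only [y, if_neg hi] using hge (r - s) (by linarith) (x i)

/-- Let `I, J` be nonempty disjoint subsets of `[n]` with
`I ∪ J = [n]`, and `x, a ∈ (Rmax)^n`, both `≠ ⊥`. With `M_I = max_{i∈I}(x_i+a_i)` and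
`M_J = max_{j∈J}(x_j+a_j)`: if at least one of `M_I, M_J` is finite then
`dist_H(x, H^{IJ}_a) = |M_I − M_J|` (with `|r − (−∞)| = +∞`), and if both are `−∞`
then `dist_H(x, H^{IJ}_a) = 0`. -/
theorem stmt17 {n : ℕ} (I J : Set (Fin n)) (hI : I.Nonempty) (hJ : J.Nonempty)
    (hdisj : Disjoint I J) (hunion : I ∪ J = Set.univ)
    (x a : Fin n → EReal) (hx : IsRmax x) (ha : IsRmax a)
    (hxb : x ≠ ⊥) (hab : a ≠ ⊥) :
    (((⨆ i ∈ I, (x i + a i)) ≠ ⊥ ∨ (⨆ j ∈ J, (x j + a j)) ≠ ⊥) →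
      distPt x (shyper I J a) =
        max ((⨆ i ∈ I, (x i + a i)) - (⨆ j ∈ J, (x j + a j)))
            ((⨆ j ∈ J, (x j + a j)) - (⨆ i ∈ I, (x i + a i)))) ∧
    (((⨆ i ∈ I, (x i + a i)) = ⊥ ∧ (⨆ j ∈ J, (x j + a j)) = ⊥) →
      distPt x (shyper I J a) = 0) := by
  have hIJ := biSup_sub_biSup_le_distPt I J a hxb
  have hJI := biSup_sub_biSup_le_distPt J I a hxb
  rw [shyper_comm] at hJI
  refine ⟨fun h => le_antisymm ?_ (max_le hIJ hJI), fun ⟨hMI, hMJ⟩ => le_antisymm ?_ ?_⟩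
  · by_cases hMI : (⨆ i ∈ I, (x i + a i)) = ⊥
    · have hMJ := h.resolve_left (not_not.mpr hMI)
      rw [hMI, EReal.sub_bot hMJ, max_eq_right le_top]
      exact le_top
    by_cases hMJ : (⨆ j ∈ J, (x j + a j)) = ⊥
    · rw [hMJ, EReal.sub_bot hMI, max_eq_left le_top]
      exact le_top
    have hr := (EReal.coe_toReal (biSup_add_ne_top I hx ha) hMI).symm
    have hs := (EReal.coe_toReal (biSup_add_ne_top J hx ha) hMJ).symm
    generalize (⨆ i ∈ I, (x i + a i)).toReal = r at hr
    generalize (⨆ j ∈ J, (x j + a j)).toReal = s at hs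
    rw [hr, hs]
    rcases le_total s r with hsr | hrs
    · exact (distPt_shyper_le hdisj hx hxb hr hs hsr).trans (le_max_left _ _)
    · rw [shyper_comm]
      exact (distPt_shyper_le hdisj.symm hx hxb hs hr hrs).trans (le_max_right _ _)
  · have hmem : x ∈ shyper I J a := ⟨hx, by simp only [add_comm (a _), hMI, hMJ]⟩
    refine (iInf₂_le x hmem).trans ?_
    simpa using hd_le hxb 0 0 (fun i => by simp) (fun i => by simp)
  · exact le_iInf₂ fun y hy => hd_nonneg hxb hy.1

end TropReg
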